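/- For every τ ≥ 2 and every Z ⊆ K with Σ_{a∈Z} δ_a ≤ τ: (i) there exists a phase-independent algorithm committed to Z (the algorithm LCB(Z)) whose expected first-phase reward satisfies E_{q∼P^τ}[r_{1:τ}^{LCB(Z)}(q)] ≥ DOAlg(c^+,Z) − 2n/τ; and (ii) DOAlg(c^+,Z) ≥ E_{q∼P^τ}[r_{1:τ}^{PICO(Z)}(q)] − n·(√(τ·log τ) + 2). -/

import Mathlib

open scoped BigOperators Classical

namespace ExposureBandits

/-- Number of pulls of arm `a` in the (0-indexed) phase `j` of the pull sequence `pull`. -/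
def pullsInPhase {k : ℕ} (T τ : ℕ) (pull : Fin T → Fin k) (j : ℕ) (a : Fin k) : ℕ :=
  (Finset.univ.filter (fun t : Fin T =>
    j * τ ≤ (t : ℕ) ∧ (t : ℕ) < (j + 1) * τ ∧ pull t = a)).card

/-- Arm `a` is available at round `t` iff its exposure constraint was satisfied in every
completed phase. -/
def availableAt {k : ℕ} (T τ : ℕ) (δ : Fin k → ℕ) (pull : Fin T → Fin k)
    (t : Fin T) (a : Fin k) : Prop :=
  ∀ j : ℕ, (j + 1) * τ ≤ (t : ℕ) → δ a ≤ pullsInPhase T τ pull j a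

/-- Conditional-expected reward of the pull sequence `pull` on the arrival sequence `q`:
pulls of unavailable (departed) arms yield zero utility. -/
noncomputable def seqReward {k n : ℕ} (T τ : ℕ) (μ : Fin n → Fin k → ℝ) (δ : Fin k → ℕ)
    (pull : Fin T → Fin k) (q : Fin T → Fin n) : ℝ :=
  ∑ t : Fin T, if availableAt T τ δ pull t (pull t) then μ (q t) (pull t) else 0

/-- A deterministic online algorithm for the stochastic-optimization task: the arm pulled at
round `t` may depend only on the types observed in rounds `1,…,t`. -/
def Causal {k n T : ℕ} (f : (Fin T → Fin n) → Fin T → Fin k) : Prop :=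
  ∀ q q' : Fin T → Fin n, ∀ t : Fin T,
    (∀ s : Fin T, s ≤ t → q s = q' s) → f q t = f q' t

abbrev Alg (k n T : ℕ) := {f : (Fin T → Fin n) → Fin T → Fin k // Causal f}

/-- Probability of the i.i.d. arrival sequence `q` under the arrival distribution `P`. -/
noncomputable def seqProb {n : ℕ} (T : ℕ) (P : Fin n → ℝ) (q : Fin T → Fin n) : ℝ :=
  ∏ t : Fin T, P (q t)

/-- Expected reward of the algorithm `A`. -/
noncomputable def expReward {k n : ℕ} (T τ : ℕ) (P : Fin n → ℝ) (μ : Fin n → Fin k → ℝ)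
    (δ : Fin k → ℕ) (A : Alg k n T) : ℝ :=
  ∑ q : Fin T → Fin n, seqProb T P q * seqReward T τ μ δ (A.1 q) q

/-- The optimal expected reward: the value of the benchmark `OPT`. -/
noncomputable def optReward (k n T τ : ℕ) (P : Fin n → ℝ) (μ : Fin n → Fin k → ℝ)
    (δ : Fin k → ℕ) : ℝ :=
  ⨆ A : Alg k n T, expReward T τ P μ δ A

/-- Property 1 (phase independence): whenever the type prefixes of two phases agree, the
algorithm's pulls at the corresponding rounds agree. -/
def PhaseInd {k n T : ℕ} (τ : ℕ) (A : Alg k n T) : Prop :=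
  ∀ q : Fin T → Fin n, ∀ i j s : ℕ, s < τ →
    ∀ (hi : i * τ + s < T) (hj : j * τ + s < T),
      (∀ l : ℕ, l ≤ s → ∀ (hli : i * τ + l < T) (hlj : j * τ + l < T),
          q ⟨i * τ + l, hli⟩ = q ⟨j * τ + l, hlj⟩) →
      A.1 q ⟨i * τ + s, hi⟩ = A.1 q ⟨j * τ + s, hj⟩

/-- Property 2 (commitment to `Z`): the algorithm pulls only arms of `Z` and, with
probability 1, every arm of `Z` receives at least its exposure threshold in every phase. -/
def Committed {k n T : ℕ} (τ : ℕ) (δ : Fin k → ℕ) (Z : Finset (Fin k)) (A : Alg k n T) : Prop :=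
  ∀ q : Fin T → Fin n,
    (∀ t : Fin T, A.1 q t ∈ Z) ∧
    (∀ j : ℕ, (j + 1) * τ ≤ T → ∀ a ∈ Z, δ a ≤ pullsInPhase T τ (A.1 q) j a)

/-- The value of `PICO`: the best expected reward among phase-independent algorithms committed
to some subset of the arms. -/
noncomputable def picoReward (k n T τ : ℕ) (P : Fin n → ℝ) (μ : Fin n → Fin k → ℝ)
    (δ : Fin k → ℕ) : ℝ :=
  ⨆ A : {A : Alg k n T // PhaseInd τ A ∧ ∃ Z : Finset (Fin k), Committed τ δ Z A},
    expReward T τ P μ δ A.1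

/-- Expected first-phase reward of the algorithm `A` (for committed algorithms this is
`E_{q ∼ P^τ}[r_{1:τ}^A(q)]`). -/
noncomputable def expFirstPhase (k n T τ : ℕ) (P : Fin n → ℝ) (μ : Fin n → Fin k → ℝ)
    (A : Alg k n T) : ℝ :=
  ∑ q : Fin T → Fin n, seqProb T P q *
    ∑ t ∈ Finset.univ.filter (fun t : Fin T => (t : ℕ) < τ), μ (q t) (A.1 q t)

/-- The expected first-phase reward of `PICO(Z)`: the best expected first-phase reward over
phase-independent algorithms committed to `Z`. -/
noncomputable def picoZReward (k n T τ : ℕ) (P : Fin n → ℝ) (μ : Fin n → Fin k → ℝ)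
    (δ : Fin k → ℕ) (Z : Finset (Fin k)) : ℝ :=
  ⨆ A : {A : Alg k n T // PhaseInd τ A ∧ Committed τ δ Z A},
    expFirstPhase k n T τ P μ A.1

/-- The aggregate `c(q)`: the number of arrivals of each user type in the sequence `q`. -/
def typeCount {n : ℕ} (τ : ℕ) (q : Fin τ → Fin n) (u : Fin n) : ℕ :=
  (Finset.univ.filter (fun t : Fin τ => q t = u)).card

/-- `DOAlg(c, Z)`: the maximum reward of a matching of the users given by the aggregate `c`
to the arms of `Z`, satisfying the exposure constraints of every arm of `Z`. -/
noncomputable def DOAlgR {k m : ℕ} (μ : Fin m → Fin k → ℝ) (δ : Fin k → ℕ)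
    (c : Fin m → ℕ) (Z : Finset (Fin k)) : ℝ :=
  sSup {r : ℝ | ∃ M : Fin m → Fin k → ℕ,
    (∀ u, ∑ a, M u a = c u) ∧ (∀ u a, a ∉ Z → M u a = 0) ∧
    (∀ a ∈ Z, δ a ≤ ∑ u, M u a) ∧
    r = ∑ u, ∑ a, (M u a : ℝ) * μ u a}

/-- The utility matrix augmented with the slack user type `u⋆` (the last index), whose utility
is `0` for every arm. -/
noncomputable def muPlus {k n : ℕ} (μ : Fin n → Fin k → ℝ) : Fin (n + 1) → Fin k → ℝ :=
  Fin.snoc μ (fun _ => 0)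

/-- `c⁺_u = ⌊P_u·τ − √(τ·log τ)⌋` for a real user type `u`. -/
noncomputable def cplusBase {n : ℕ} (P : Fin n → ℝ) (τ : ℕ) (u : Fin n) : ℕ :=
  ⌊P u * τ - Real.sqrt (τ * Real.log τ)⌋₊

/-- The augmented lower-confidence aggregate `c⁺`: its last entry is the number of slack
users, absorbing the gap between the lower confidence bounds and the phase length. -/
noncomputable def cplus {n : ℕ} (P : Fin n → ℝ) (τ : ℕ) : Fin (n + 1) → ℕ :=
  Fin.snoc (cplusBase P τ) (τ - ∑ u, cplusBase P τ u)



/-- Sum over sequences of a product factorizes. -/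
lemma sum_seq_prod {n T : ℕ} (f : Fin T → Fin n → ℝ) :
    ∑ q : Fin T → Fin n, ∏ t, f t (q t) = ∏ t, ∑ v, f t v := by
  rw [Finset.prod_univ_sum, Fintype.piFinset_univ]

lemma sum_seqProb {n T : ℕ} (P : Fin n → ℝ) (hPsum : ∑ u, P u = 1) :
    ∑ q : Fin T → Fin n, seqProb T P q = 1 := by
  unfold seqProb
  rw [sum_seq_prod (fun _ v => P v)]
  simp [hPsum]

lemma seqProb_nonneg {n T : ℕ} (P : Fin n → ℝ) (hP : ∀ u, 0 < P u) (q : Fin T → Fin n) :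
    0 ≤ seqProb T P q := Finset.prod_nonneg fun _ _ => (hP _).le

lemma sum_seqProb_ind {n T : ℕ} (P : Fin n → ℝ) (hPsum : ∑ u, P u = 1) (t : Fin T) (u : Fin n) :
    ∑ q : Fin T → Fin n, seqProb T P q * (if q t = u then (1 : ℝ) else 0) = P u := by
  have h : ∀ q : Fin T → Fin n, seqProb T P q * (if q t = u then (1 : ℝ) else 0)
      = ∏ s, (P (q s) * (if s = t then (if q s = u then (1 : ℝ) else 0) else 1)) := by
    intro q
    rw [Finset.prod_mul_distrib]
    simp [seqProb, Finset.prod_ite_eq']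
  simp_rw [h]
  rw [sum_seq_prod (fun s v => P v * (if s = t then (if v = u then (1 : ℝ) else 0) else 1))]
  have h2 : ∀ s : Fin T, ∑ v, P v * (if s = t then (if v = u then (1 : ℝ) else 0) else 1)
      = if s = t then P u else 1 := by
    intro s
    by_cases hs : s = t
    · simp [hs]
    · simp [hs, hPsum]
  simp_rw [h2]
  simp

/-- Number of arrivals of type `u` in the first phase. -/
def cnt {n T : ℕ} (τ : ℕ) (q : Fin T → Fin n) (u : Fin n) : ℕ :=
  (Finset.univ.filter (fun t : Fin T => (t : ℕ) < τ ∧ q t = u)).card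

lemma card_first {T τ : ℕ} (h : τ ≤ T) :
    (Finset.univ.filter (fun t : Fin T => (t : ℕ) < τ)).card = τ := by
  rw [Fin.card_filter_val_lt]
  omega

lemma cnt_eq_sum {n T : ℕ} (τ : ℕ) (q : Fin T → Fin n) (u : Fin n) :
    (cnt τ q u : ℝ) = ∑ t ∈ Finset.univ.filter (fun t : Fin T => (t : ℕ) < τ),
      (if q t = u then (1 : ℝ) else 0) := by
  unfold cnt
  rw [Finset.sum_boole, Finset.filter_filter]

lemma exp_cnt {n T τ : ℕ} (hT : τ ≤ T) (P : Fin n → ℝ) (hPsum : ∑ u, P u = 1) (u : Fin n) :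
    ∑ q : Fin T → Fin n, seqProb T P q * (cnt τ q u : ℝ) = P u * τ := by
  simp_rw [cnt_eq_sum, Finset.mul_sum]
  rw [Finset.sum_comm]
  simp_rw [sum_seqProb_ind P hPsum]
  rw [Finset.sum_const, card_first hT, nsmul_eq_mul, mul_comm]

open MeasureTheory ProbabilityTheory in
/-- Hoeffding's lemma for a Bernoulli variable. -/
lemma bernoulli_mgf (p l : ℝ) (h0 : 0 ≤ p) (h1 : p ≤ 1) :
    1 - p + p * Real.exp l ≤ Real.exp (l * p + l ^ 2 / 8) := by
  let ν : Measure ℝ := ENNReal.ofReal (1 - p) • Measure.dirac 0 + ENNReal.ofReal p • Measure.dirac 1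
  have hint : ∀ f : ℝ → ℝ, ∫ x, f x ∂ν = (1 - p) * f 0 + p * f 1 := by
    intro f
    rw [integral_add_measure, integral_smul_measure, integral_smul_measure]
    · simp [ENNReal.toReal_ofReal, h0, h1]
    · exact (integrable_dirac (by simp)).smul_measure (by simp)
    · exact (integrable_dirac (by simp)).smul_measure (by simp)
  have : IsProbabilityMeasure ν := ⟨by
    simp only [ν, Measure.add_apply, Measure.smul_apply, measure_univ, smul_eq_mul, mul_one]
    rw [← ENNReal.ofReal_add (by linarith) h0]; simp⟩
  have hb : ∀ᵐ x ∂ν, (id x : ℝ) ∈ Set.Icc (0:ℝ) 1 := by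
    simp only [ν]
    rw [ae_add_measure_iff]
    constructor
    · exact (Measure.ae_smul_measure (by rw [ae_dirac_eq]; simp) _)
    · exact (Measure.ae_smul_measure (by rw [ae_dirac_eq]; simp) _)
  have h := (hasSubgaussianMGF_of_mem_Icc (μ := ν) (X := id) aemeasurable_id hb).mgf_le l
  simp only [mgf, hint, id] at h
  norm_num at h
  have e1 : Real.exp (l * (1 - p)) = Real.exp l * Real.exp (-(l * p)) := by
    rw [← Real.exp_add]; ring_nf
  have e3 : (1 - p + p * Real.exp l) * Real.exp (-(l*p)) ≤ Real.exp (l^2/8) := by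
    rw [e1] at h
    calc _ = (1 - p) * Real.exp (-(l * p)) + p * (Real.exp l * Real.exp (-(l * p))) := by ring
      _ ≤ _ := h
      _ = _ := by congr 1; ring
  calc 1 - p + p * Real.exp l
      = ((1 - p + p * Real.exp l) * Real.exp (-(l*p))) * Real.exp (l * p) := by
        rw [mul_assoc, ← Real.exp_add]; simp
    _ ≤ Real.exp (l^2/8) * Real.exp (l * p) := by gcongr
    _ = _ := by rw [← Real.exp_add]; ring_nf

lemma mgf_cnt {n T τ : ℕ} (hT : τ ≤ T) (P : Fin n → ℝ) (hPsum : ∑ u, P u = 1) (u : Fin n)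
    (l : ℝ) :
    ∑ q : Fin T → Fin n, seqProb T P q * Real.exp (l * cnt τ q u)
      = (1 - P u + P u * Real.exp l) ^ τ := by
  have h : ∀ q : Fin T → Fin n, seqProb T P q * Real.exp (l * cnt τ q u)
      = ∏ t, (P (q t) * (if (t : ℕ) < τ then (if q t = u then Real.exp l else 1) else 1)) := by
    intro q
    rw [Finset.prod_mul_distrib, seqProb, cnt_eq_sum, Finset.mul_sum, Real.exp_sum,
      Finset.prod_filter]
    congr 1
    apply Finset.prod_congr rfl
    intro t _
    split_ifs <;> simp
  simp_rw [h]
  rw [sum_seq_prod (fun (t : Fin T) v =>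
    P v * (if (t : ℕ) < τ then (if v = u then Real.exp l else 1) else 1))]
  have h2 : ∀ t : Fin T, ∑ v, P v * (if (t : ℕ) < τ then (if v = u then Real.exp l else 1) else 1)
      = if (t : ℕ) < τ then (1 - P u + P u * Real.exp l) else 1 := by
    intro t
    by_cases ht : (t : ℕ) < τ
    · simp only [ht, if_true]
      have : ∀ v, P v * (if v = u then Real.exp l else 1)
          = P v + (if v = u then P v * (Real.exp l - 1) else 0) := by
        intro v; split_ifs <;> ring
      simp_rw [this]
      rw [Finset.sum_add_distrib, hPsum]
      simp
      ring
    · simp [ht, hPsum]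
  simp_rw [h2]
  rw [← Finset.prod_filter, Finset.prod_const, card_first hT]

/-- Lower-tail Hoeffding bound at the confidence radius. -/
lemma bad_prob {n T τ : ℕ} (hτ : 2 ≤ τ) (hT : τ ≤ T) (P : Fin n → ℝ) (hP : ∀ u, 0 < P u)
    (hPsum : ∑ u, P u = 1)
    (hcz : ∀ u : Fin n, 0 ≤ P u * (τ : ℝ) - Real.sqrt ((τ : ℝ) * Real.log (τ : ℝ)))
    (u : Fin n) :
    ∑ q : Fin T → Fin n, seqProb T P q * (if cnt τ q u < cplusBase P τ u then (1 : ℝ) else 0)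
      ≤ 1 / (τ : ℝ) ^ 2 := by
  set s := Real.sqrt ((τ : ℝ) * Real.log (τ : ℝ)) with hs
  have hτ0 : (0 : ℝ) < τ := by positivity
  have hlog : 0 ≤ Real.log τ := Real.log_natCast_nonneg τ
  have hs2 : s ^ 2 = τ * Real.log τ := Real.sq_sqrt (by positivity)
  have hs0 : 0 ≤ s := Real.sqrt_nonneg _
  have hp1 : P u ≤ 1 := by
    rw [← hPsum]; exact Finset.single_le_sum (fun i _ => (hP i).le) (Finset.mem_univ u)
  set l : ℝ := 4 * s / τ with hl
  have hl0 : 0 ≤ l := by positivity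
  calc ∑ q : Fin T → Fin n, seqProb T P q * (if cnt τ q u < cplusBase P τ u then (1 : ℝ) else 0)
      ≤ ∑ q : Fin T → Fin n, seqProb T P q *
          (Real.exp (l * (P u * τ - s)) * Real.exp ((-l) * cnt τ q u)) := by
        apply Finset.sum_le_sum
        intro q _
        apply mul_le_mul_of_nonneg_left _ (seqProb_nonneg P hP q)
        split_ifs with h
        · rw [← Real.exp_add]
          apply Real.one_le_exp
          have h1 : (cplusBase P τ u : ℝ) ≤ P u * τ - s := Nat.floor_le (hcz u)
          have h2 : (cnt τ q u : ℝ) ≤ cplusBase P τ u := by exact_mod_cast h.le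
          nlinarith
        · positivity
    _ = Real.exp (l * (P u * τ - s)) * (1 - P u + P u * Real.exp (-l)) ^ τ := by
        rw [← mgf_cnt hT P hPsum u (-l), Finset.mul_sum]
        apply Finset.sum_congr rfl
        intro q _; ring
    _ ≤ Real.exp (l * (P u * τ - s)) * (Real.exp ((-l) * P u + (-l) ^ 2 / 8)) ^ τ := by
        gcongr
        · have := Real.exp_pos (-l)
          have := hP u
          nlinarith [mul_pos this (Real.exp_pos (-l))]
        · exact bernoulli_mgf _ _ (hP u).le hp1
    _ = Real.exp (-(2 * Real.log τ)) := by
        rw [← Real.exp_nat_mul, ← Real.exp_add]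
        congr 1
        have : l * s = 4 * Real.log τ := by
          rw [hl]; field_simp; rw [hs2]
        have h2 : (τ : ℝ) * l ^ 2 = 16 * Real.log τ := by
          rw [hl]; field_simp; rw [hs2]; ring
        nlinarith
    _ = 1 / (τ : ℝ) ^ 2 := by
        rw [Real.exp_neg, mul_comm, Real.exp_mul, Real.exp_log hτ0]
        norm_num

section MultisetTools

variable {α β : Type*}

lemma exists_le_map (f : α → β) (t : Multiset α) : ∀ s : Multiset β, s ≤ t.map f →
    ∃ u ≤ t, u.map f = s := by
  induction t using Multiset.induction_on with
  | empty => intro s hs; exact ⟨0, le_rfl, (by simpa using hs : s = 0).symm⟩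
  | cons a t ih =>
    intro s hs
    by_cases ha : f a ∈ s
    · obtain ⟨s', rfl⟩ := Multiset.exists_cons_of_mem ha
      rw [Multiset.map_cons, Multiset.cons_le_cons_iff] at hs
      obtain ⟨u, hu, rfl⟩ := ih s' hs
      exact ⟨a ::ₘ u, (Multiset.cons_le_cons_iff a).2 hu, by simp⟩
    · rw [Multiset.map_cons, Multiset.le_cons_of_notMem ha] at hs
      obtain ⟨u, hu, rfl⟩ := ih s hs
      exact ⟨u, hu.trans (Multiset.le_cons_self _ _), rfl⟩

lemma exists_zip (s : Multiset α) : ∀ t : Multiset β, s.card = t.card →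
    ∃ R : Multiset (α × β), R.map Prod.fst = s ∧ R.map Prod.snd = t := by
  induction s using Multiset.induction_on with
  | empty => intro t h; exact ⟨0, rfl, (by simpa using h.symm : t = 0).symm⟩
  | cons a s ih =>
    intro t h
    obtain ⟨b, hb⟩ : ∃ b, b ∈ t := by
      apply Multiset.card_pos_iff_exists_mem.1; rw [← h]; simp
    obtain ⟨t, rfl⟩ := Multiset.exists_cons_of_mem hb
    obtain ⟨R, h1, h2⟩ := ih t (by simpa using h)
    exact ⟨(a, b) ::ₘ R, by simp [h1], by simp [h2]⟩

/-- Relabelling the first coordinates to a prescribed multiset. -/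
lemma relabel [DecidableEq α] [DecidableEq β] (R : Multiset (α × β)) (C : Multiset α)
    (hc : R.card = C.card)
    (f : α × β → ℝ) (h0 : ∀ x, 0 ≤ f x) (h1 : ∀ x, f x ≤ 1) :
    ∃ R' : Multiset (α × β), R'.map Prod.fst = C ∧ R'.map Prod.snd = R.map Prod.snd ∧
      (R.map f).sum ≤ (R'.map f).sum + ((R.map Prod.fst - C).card : ℝ) := by
  obtain ⟨R1, hR1, hm⟩ := exists_le_map Prod.fst R (R.map Prod.fst ∩ C) Multiset.inter_le_left
  obtain ⟨R2, rfl⟩ := Multiset.le_iff_exists_add.1 hR1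
  have e1 : R2.map Prod.fst = (R1 + R2).map Prod.fst - C := by
    have h := Multiset.sub_add_inter ((R1 + R2).map Prod.fst) C
    rw [← hm] at h
    nth_rewrite 2 [Multiset.map_add] at h
    rw [add_comm] at h
    exact (add_left_cancel h).symm
  have e2 : C = R1.map Prod.fst + (C - (R1 + R2).map Prod.fst) := by
    have h := Multiset.sub_add_inter C ((R1 + R2).map Prod.fst)
    rw [Multiset.inter_comm, ← hm, add_comm] at h
    exact h.symm
  obtain ⟨R3, h31, h32⟩ := exists_zip (C - (R1 + R2).map Prod.fst) (R2.map Prod.snd) (by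
    have := congrArg Multiset.card e2
    simp only [Multiset.card_add, Multiset.card_map] at this hc ⊢
    omega)
  refine ⟨R1 + R3, ?_, ?_, ?_⟩
  · rw [Multiset.map_add, h31, ← e2]
  · rw [Multiset.map_add, Multiset.map_add, h32]
  · rw [← e1, Multiset.card_map, Multiset.map_add, Multiset.map_add, Multiset.sum_add,
      Multiset.sum_add]
    have a1 : (R2.map f).sum ≤ (R2.card : ℝ) := by
      have := Multiset.sum_le_card_nsmul (R2.map f) (1 : ℝ) (by
        intro x hx
        obtain ⟨y, _, rfl⟩ := Multiset.mem_map.1 hx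
        exact h1 y)
      simpa using this
    have a2 : 0 ≤ (R3.map f).sum := Multiset.sum_nonneg (by
        intro x hx
        obtain ⟨y, _, rfl⟩ := Multiset.mem_map.1 hx
        exact h0 y)
    linarith

lemma count_map_fst [Fintype β] [DecidableEq α] [DecidableEq β] (R : Multiset (α × β)) (v : α) :
    (R.map Prod.fst).count v = ∑ a, R.count (v, a) := by
  induction R using Multiset.induction_on with
  | empty => simp
  | cons x R ih =>
    obtain ⟨w, b⟩ := x
    simp only [Multiset.map_cons, Multiset.count_cons, ih, Finset.sum_add_distrib]
    by_cases h : v = w <;> simp [h]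

lemma count_map_snd [Fintype α] [DecidableEq α] [DecidableEq β] (R : Multiset (α × β)) (a : β) :
    (R.map Prod.snd).count a = ∑ v, R.count (v, a) := by
  induction R using Multiset.induction_on with
  | empty => simp
  | cons x R ih =>
    obtain ⟨w, b⟩ := x
    simp only [Multiset.map_cons, Multiset.count_cons, ih, Finset.sum_add_distrib]
    by_cases h : a = b <;> simp [h]

lemma sum_map_eq [Fintype α] [Fintype β] [DecidableEq α] [DecidableEq β] (R : Multiset (α × β))
    (f : α → β → ℝ) :
    (R.map (fun x => f x.1 x.2)).sum = ∑ v, ∑ a, (R.count (v, a) : ℝ) * f v a := by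
  induction R using Multiset.induction_on with
  | empty => simp
  | cons x R ih =>
    obtain ⟨w, b⟩ := x
    simp only [Multiset.map_cons, Multiset.count_cons, Multiset.sum_cons, ih, Nat.cast_add,
      add_mul, Finset.sum_add_distrib]
    rw [add_comm]
    congr 1
    rw [← Fintype.sum_prod_type' (f := fun v a => ((if (v, a) = (w, b) then 1 else 0 : ℕ) : ℝ) * f v a)]
    rw [Finset.sum_eq_single (w, b)] <;> simp +contextual

lemma exists_of_count [Fintype α] [DecidableEq α] (c : α → ℕ) :
    ∃ C : Multiset α, (∀ v, C.count v = c v) ∧ C.card = ∑ v, c v := by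
  refine ⟨∑ v, Multiset.replicate (c v) v, ?_, by simp⟩
  intro v
  rw [Multiset.count_sum']
  simp [Multiset.count_replicate]

end MultisetTools

/-- Multiset form of a feasible matching. -/
def Feas {k m : ℕ} (δ : Fin k → ℕ) (c : Fin m → ℕ) (Z : Finset (Fin k))
    (R : Multiset (Fin m × Fin k)) : Prop :=
  (∀ v, (R.map Prod.fst).count v = c v) ∧ (∀ x ∈ R, x.2 ∈ Z) ∧
    ∀ a ∈ Z, δ a ≤ (R.map Prod.snd).count a

lemma doalg_set_eq {k m : ℕ} (μ : Fin m → Fin k → ℝ) (δ : Fin k → ℕ)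
    (c : Fin m → ℕ) (Z : Finset (Fin k)) :
    {r : ℝ | ∃ M : Fin m → Fin k → ℕ,
    (∀ u, ∑ a, M u a = c u) ∧ (∀ u a, a ∉ Z → M u a = 0) ∧
    (∀ a ∈ Z, δ a ≤ ∑ u, M u a) ∧
    r = ∑ u, ∑ a, (M u a : ℝ) * μ u a} =
    {r : ℝ | ∃ R, Feas δ c Z R ∧ r = (R.map (fun x => μ x.1 x.2)).sum} := by
  ext r
  constructor
  · rintro ⟨M, h1, h2, h3, rfl⟩
    obtain ⟨R, hR, -⟩ := exists_of_count (fun x : Fin m × Fin k => M x.1 x.2)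
    refine ⟨R, ⟨?_, ?_, ?_⟩, ?_⟩
    · intro v; rw [count_map_fst]; simp_rw [hR]; exact h1 v
    · intro x hx
      by_contra hZ
      have := Multiset.count_pos.2 hx
      rw [hR, h2 _ _ hZ] at this
      exact absurd this (lt_irrefl _)
    · intro a ha; rw [count_map_snd]; simp_rw [hR]; exact h3 a ha
    · rw [sum_map_eq]; simp_rw [hR]
  · rintro ⟨R, ⟨h1, h2, h3⟩, rfl⟩
    refine ⟨fun v a => R.count (v, a), ?_, ?_, ?_, ?_⟩
    · intro v; rw [← count_map_fst]; exact h1 v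
    · intro v a ha
      apply Multiset.count_eq_zero.2
      intro hx; exact ha (h2 _ hx)
    · intro a ha; rw [← count_map_snd]; exact h3 a ha
    · rw [sum_map_eq]

lemma doalg_finite {k m : ℕ} (μ : Fin m → Fin k → ℝ) (δ : Fin k → ℕ)
    (c : Fin m → ℕ) (Z : Finset (Fin k)) :
    {r : ℝ | ∃ M : Fin m → Fin k → ℕ,
    (∀ u, ∑ a, M u a = c u) ∧ (∀ u a, a ∉ Z → M u a = 0) ∧
    (∀ a ∈ Z, δ a ≤ ∑ u, M u a) ∧
    r = ∑ u, ∑ a, (M u a : ℝ) * μ u a}.Finite := by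
  apply ((Set.finite_Iic (fun u (_ : Fin k) => c u)).image
    (fun M => ∑ u, ∑ a, (M u a : ℝ) * μ u a)).subset
  rintro r ⟨M, h1, -, -, rfl⟩
  refine ⟨M, ?_, rfl⟩
  intro u a
  change M u a ≤ c u
  rw [← h1 u]
  exact Finset.single_le_sum (f := M u) (fun _ _ => Nat.zero_le _) (Finset.mem_univ a)

lemma le_doalg {k m : ℕ} (μ : Fin m → Fin k → ℝ) (δ : Fin k → ℕ)
    (c : Fin m → ℕ) (Z : Finset (Fin k)) (R : Multiset (Fin m × Fin k)) (hR : Feas δ c Z R) :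
    (R.map (fun x => μ x.1 x.2)).sum ≤ DOAlgR μ δ c Z := by
  unfold DOAlgR
  apply le_csSup (doalg_finite μ δ c Z).bddAbove
  rw [doalg_set_eq]
  exact ⟨R, hR, rfl⟩

lemma doalg_attained {k m : ℕ} (μ : Fin m → Fin k → ℝ) (δ : Fin k → ℕ)
    (c : Fin m → ℕ) (Z : Finset (Fin k)) (hZne : Z.Nonempty) (hZ : ∑ a ∈ Z, δ a ≤ ∑ v, c v) :
    ∃ R, Feas δ c Z R ∧ DOAlgR μ δ c Z = (R.map (fun x => μ x.1 x.2)).sum := by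
  have hf := doalg_finite μ δ c Z
  have hne : {r : ℝ | ∃ R, Feas δ c Z R ∧ r = (R.map (fun x => μ x.1 x.2)).sum}.Nonempty := by
    obtain ⟨z, hz⟩ := hZne
    obtain ⟨C, hC, hCc⟩ := exists_of_count c
    obtain ⟨B, hB, hBc⟩ := exists_of_count (fun a => if a ∈ Z then δ a else 0)
    have hs : ∑ a, (if a ∈ Z then δ a else 0) = ∑ a ∈ Z, δ a := by simp
    obtain ⟨R, h1, h2⟩ := exists_zip C
      (B + Multiset.replicate (∑ v, c v - ∑ a ∈ Z, δ a) z) (by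
        rw [Multiset.card_add, Multiset.card_replicate, hCc, hBc, hs]; omega)
    refine ⟨_, R, ⟨?_, ?_, ?_⟩, rfl⟩
    · rw [h1]; exact hC
    · intro x hx
      have hx2 : x.2 ∈ R.map Prod.snd := Multiset.mem_map_of_mem _ hx
      rw [h2, Multiset.mem_add] at hx2
      rcases hx2 with hx2 | hx2
      · by_contra hn
        have := Multiset.count_pos.2 hx2
        rw [hB] at this
        simp [hn] at this
      · rw [Multiset.eq_of_mem_replicate hx2]; exact hz
    · intro a ha
      rw [h2, Multiset.count_add, hB]
      simp [ha]
  rw [← doalg_set_eq] at hne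
  have := hne.csSup_mem hf
  rw [doalg_set_eq] at this
  obtain ⟨R, hR, h⟩ := this
  refine ⟨R, hR, ?_⟩
  rw [← h]; unfold DOAlgR; rw [doalg_set_eq]

section Greedy

variable {k n : ℕ}

/-- The slot selected for a type `u` user from the remaining slots `R`: a slot of its own row,
else a slack slot, else any slot. -/
noncomputable def sel (d : Fin (n + 1) × Fin k) (R : Multiset (Fin (n + 1) × Fin k)) (u : Fin n) :
    Fin (n + 1) × Fin k :=
  if h : ∃ x ∈ R, x.1 = Fin.castSucc u then h.choose
  else if h : ∃ x ∈ R, x.1 = Fin.last n then h.choose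
  else if h : ∃ x, x ∈ R then h.choose else d

lemma sel_mem (d : Fin (n + 1) × Fin k) (R : Multiset (Fin (n + 1) × Fin k)) (u : Fin n)
    (hR : 0 < R.card) : sel d R u ∈ R := by
  have hR := Multiset.card_pos_iff_exists_mem.1 hR
  unfold sel
  split_ifs with h1 h2
  · exact h1.choose_spec.1
  · exact h2.choose_spec.1
  · exact hR.choose_spec

lemma sel_own (d : Fin (n + 1) × Fin k) (R : Multiset (Fin (n + 1) × Fin k)) (u : Fin n)
    (h : ∃ x ∈ R, x.1 = Fin.castSucc u) : (sel d R u).1 = Fin.castSucc u := by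
  unfold sel
  rw [dif_pos h]
  exact h.choose_spec.2

lemma sel_slack (d : Fin (n + 1) × Fin k) (R : Multiset (Fin (n + 1) × Fin k)) (u : Fin n)
    (h' : ¬ ∃ x ∈ R, x.1 = Fin.castSucc u)
    (h : ∃ x ∈ R, x.1 = Fin.last n) : (sel d R u).1 = Fin.last n := by
  unfold sel
  rw [dif_neg h', dif_pos h]
  exact h.choose_spec.2

/-- Remaining slots after `s` rounds of the phase. -/
noncomputable def st (d : Fin (n + 1) × Fin k) (R : Multiset (Fin (n + 1) × Fin k)) (w : ℕ → Fin n) :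
    ℕ → Multiset (Fin (n + 1) × Fin k)
  | 0 => R
  | s + 1 => (st d R w s).erase (sel d (st d R w s) (w s))

/-- Slot used at round `s` of the phase. -/
noncomputable def pl (d : Fin (n + 1) × Fin k) (R : Multiset (Fin (n + 1) × Fin k)) (w : ℕ → Fin n)
    (s : ℕ) : Fin (n + 1) × Fin k := sel d (st d R w s) (w s)

lemma st_congr (d : Fin (n + 1) × Fin k) (R : Multiset (Fin (n + 1) × Fin k)) (w w' : ℕ → Fin n)
    (s : ℕ) (h : ∀ i < s, w i = w' i) : st d R w s = st d R w' s := by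
  induction s with
  | zero => rfl
  | succ s ih =>
    simp only [st]
    rw [ih (fun i hi => h i (by omega)), h s (by omega)]

lemma pl_congr (d : Fin (n + 1) × Fin k) (R : Multiset (Fin (n + 1) × Fin k)) (w w' : ℕ → Fin n)
    (s : ℕ) (h : ∀ i ≤ s, w i = w' i) : pl d R w s = pl d R w' s := by
  unfold pl
  rw [st_congr d R w w' s (fun i hi => h i hi.le), h s le_rfl]

lemma st_inv (d : Fin (n + 1) × Fin k) (R : Multiset (Fin (n + 1) × Fin k)) (w : ℕ → Fin n)
    (s : ℕ) (hs : s ≤ R.card) :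
    (st d R w s).card = R.card - s ∧ st d R w s + (Multiset.range s).map (pl d R w) = R := by
  induction s with
  | zero => simp [st]
  | succ s ih =>
    obtain ⟨h1, h2⟩ := ih (by omega)
    have hm : sel d (st d R w s) (w s) ∈ st d R w s := sel_mem _ _ _ (by omega)
    constructor
    · simp only [st]
      rw [Multiset.card_erase_of_mem hm, h1]
      rw [Nat.pred_eq_sub_one, Nat.sub_sub]
    · rw [Multiset.range_succ, Multiset.map_cons]
      have := Multiset.cons_erase hm
      simp only [st]
      conv_rhs => rw [← h2, ← this]
      rw [Multiset.add_cons, Multiset.cons_add]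
      rfl

lemma st_full (d : Fin (n + 1) × Fin k) (R : Multiset (Fin (n + 1) × Fin k)) (w : ℕ → Fin n)
    (τ : ℕ) (hR : R.card = τ) : (Multiset.range τ).map (pl d R w) = R := by
  obtain ⟨h1, h2⟩ := st_inv d R w τ hR.ge
  rw [hR, Nat.sub_self, Multiset.card_eq_zero] at h1
  rw [h1, zero_add] at h2
  exact h2

lemma pl_mem (d : Fin (n + 1) × Fin k) (R : Multiset (Fin (n + 1) × Fin k)) (w : ℕ → Fin n)
    (τ : ℕ) (hR : R.card = τ) (s : ℕ) (hs : s < τ) : pl d R w s ∈ R := by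
  have h : pl d R w s ∈ (Multiset.range τ).map (pl d R w) :=
    Multiset.mem_map_of_mem _ (Multiset.mem_range.2 hs)
  rwa [st_full d R w τ hR] at h

/-- Arrivals of type `u` in rounds `s, …, τ - 1`. -/
def fut (τ : ℕ) (w : ℕ → Fin n) (s : ℕ) (u : Fin n) : ℕ :=
  ((Finset.Ico s τ).filter (fun i => w i = u)).card

lemma fut_succ (τ : ℕ) (w : ℕ → Fin n) (s : ℕ) (hs : s < τ) (u : Fin n) :
    fut τ w s u = fut τ w (s + 1) u + if w s = u then 1 else 0 := by
  unfold fut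
  rw [← Finset.insert_Ico_add_one_left_eq_Ico hs, Finset.filter_insert]
  split_ifs with h
  · rw [Finset.card_insert_of_notMem (by simp)]
  · rfl

lemma sum_fut (τ : ℕ) (w : ℕ → Fin n) (s : ℕ) : ∑ u, fut τ w s u = τ - s := by
  unfold fut
  rw [← Finset.card_eq_sum_card_fiberwise (fun _ _ => Finset.mem_coe.2 (Finset.mem_univ _))]
  simp

lemma sum_count_card {m : ℕ} (X : Multiset (Fin m)) : ∑ v, X.count v = X.card :=
  Multiset.sum_count_eq_card (fun _ _ => Finset.mem_univ _)

lemma step_inv (d : Fin (n + 1) × Fin k) (R : Multiset (Fin (n + 1) × Fin k)) (w : ℕ → Fin n)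
    (τ : ℕ) (hR : R.card = τ) (s : ℕ) (hs : s < τ)
    (hinv : ∀ u : Fin n, ((st d R w s).map Prod.fst).count (Fin.castSucc u) ≤ fut τ w s u) :
    ((pl d R w s).1 = Fin.castSucc (w s) ∨ (pl d R w s).1 = Fin.last n) ∧
    ∀ u : Fin n, ((st d R w (s + 1)).map Prod.fst).count (Fin.castSucc u) ≤ fut τ w (s + 1) u := by
  have hcard := (st_inv d R w s (by omega)).1
  have hm : pl d R w s ∈ st d R w s := sel_mem _ _ _ (by omega)
  have hst : st d R w s = pl d R w s ::ₘ st d R w (s + 1) := (Multiset.cons_erase hm).symm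
  have hcnt : ∀ v, ((st d R w s).map Prod.fst).count v
      = ((st d R w (s + 1)).map Prod.fst).count v + if v = (pl d R w s).1 then 1 else 0 := by
    intro v
    rw [hst, Multiset.map_cons, Multiset.count_cons]
  by_cases hown : ∃ x ∈ st d R w s, x.1 = Fin.castSucc (w s)
  · have h1 : (pl d R w s).1 = Fin.castSucc (w s) := sel_own _ _ _ hown
    refine ⟨Or.inl h1, fun u => ?_⟩
    have a := hinv u
    rw [hcnt, fut_succ τ w s hs, h1] at a
    by_cases hu : w s = u
    · simpa [hu] using a
    · have hu' : u ≠ w s := fun h => hu h.symm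
      simpa [hu, hu'] using a
  · have h0 : ((st d R w s).map Prod.fst).count (Fin.castSucc (w s)) = 0 := by
      rw [Multiset.count_eq_zero]
      intro hx
      obtain ⟨x, hx, hx1⟩ := Multiset.mem_map.1 hx
      exact hown ⟨x, hx, hx1⟩
    have hslack : ∃ x ∈ st d R w s, x.1 = Fin.last n := by
      by_contra hno
      have hl : ((st d R w s).map Prod.fst).count (Fin.last n) = 0 := by
        rw [Multiset.count_eq_zero]
        intro hx
        obtain ⟨x, hx, hx1⟩ := Multiset.mem_map.1 hx
        exact hno ⟨x, hx, hx1⟩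
      have hsum := sum_count_card ((st d R w s).map Prod.fst)
      rw [Fin.sum_univ_castSucc, hl, Multiset.card_map, hcard, hR, ← sum_fut τ w s] at hsum
      have hlt : ∑ u : Fin n, ((st d R w s).map Prod.fst).count (Fin.castSucc u)
          < ∑ u, fut τ w s u := by
        apply Finset.sum_lt_sum (fun u _ => hinv u)
        refine ⟨w s, Finset.mem_univ _, ?_⟩
        rw [h0, fut_succ τ w s hs]
        simp
      omega
    have h1 : (pl d R w s).1 = Fin.last n := sel_slack _ _ _ hown hslack
    refine ⟨Or.inr h1, fun u => ?_⟩
    have a := hinv u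
    by_cases hu : w s = u
    · have b := hcnt (Fin.castSucc u)
      rw [← hu, h0] at b
      rw [← hu]
      omega
    · rw [hcnt, fut_succ τ w s hs, h1] at a
      have hne : Fin.castSucc u ≠ Fin.last n := Fin.castSucc_ne_last u
      simpa [hu, hne] using a

lemma greedy_good (d : Fin (n + 1) × Fin k) (R : Multiset (Fin (n + 1) × Fin k)) (w : ℕ → Fin n)
    (τ : ℕ) (hR : R.card = τ) (μ : Fin n → Fin k → ℝ) (hμ : ∀ u a, 0 ≤ μ u a)
    (hgood : ∀ u : Fin n, (R.map Prod.fst).count (Fin.castSucc u) ≤ fut τ w 0 u) :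
    (R.map (fun x => muPlus μ x.1 x.2)).sum ≤ ∑ i ∈ Finset.range τ, μ (w i) (pl d R w i).2 := by
  have hinv : ∀ s, s ≤ τ →
      ∀ u : Fin n, ((st d R w s).map Prod.fst).count (Fin.castSucc u) ≤ fut τ w s u := by
    intro s
    induction s with
    | zero => intro _; exact hgood
    | succ s ih => intro h; exact (step_inv d R w τ hR s (by omega) (ih (by omega))).2
  have e : (R.map (fun x => muPlus μ x.1 x.2)).sum
      = ∑ i ∈ Finset.range τ, muPlus μ (pl d R w i).1 (pl d R w i).2 := by
    conv_lhs => rw [← st_full d R w τ hR]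
    rw [Multiset.map_map]
    rfl
  rw [e]
  apply Finset.sum_le_sum
  intro i hi
  have hi := Finset.mem_range.1 hi
  rcases (step_inv d R w τ hR i hi (hinv i hi.le)).1 with h | h
  · rw [h]; simp [muPlus]
  · rw [h]; simp [muPlus, hμ]

/-- Extension of a finite arrival sequence to all of `ℕ`. -/
def qext {T : ℕ} (u0 : Fin n) (q : Fin T → Fin n) (m : ℕ) : Fin n :=
  if h : m < T then q ⟨m, h⟩ else u0

/-- The pulls of `LCB(Z)`. -/
noncomputable def lcbFun (T τ : ℕ) (u0 : Fin n) (d : Fin (n + 1) × Fin k)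
    (R : Multiset (Fin (n + 1) × Fin k)) (q : Fin T → Fin n) (t : Fin T) : Fin k :=
  (pl d R (fun i => qext u0 q ((t : ℕ) / τ * τ + i)) ((t : ℕ) % τ)).2

lemma lcb_causal (T τ : ℕ) (u0 : Fin n) (d : Fin (n + 1) × Fin k)
    (R : Multiset (Fin (n + 1) × Fin k)) : Causal (lcbFun T τ u0 d R) := by
  intro q q' t h
  unfold lcbFun
  rw [pl_congr]
  intro i hi
  have := Nat.div_add_mod' (t : ℕ) τ
  have hlt : (t : ℕ) / τ * τ + i < T := by have := t.2; omega
  simp only [qext, hlt, dif_pos]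
  apply h
  rw [Fin.le_def]
  simp only
  omega

lemma lcb_at (T τ : ℕ) (u0 : Fin n) (d : Fin (n + 1) × Fin k)
    (R : Multiset (Fin (n + 1) × Fin k)) (q : Fin T → Fin n) (j s : ℕ) (hs : s < τ)
    (h : j * τ + s < T) :
    lcbFun T τ u0 d R q ⟨j * τ + s, h⟩ = (pl d R (fun i => qext u0 q (j * τ + i)) s).2 := by
  have h1 : (j * τ + s) / τ = j := by
    rw [mul_comm, Nat.mul_add_div (by omega), Nat.div_eq_of_lt hs, add_zero]
  have h2 : (j * τ + s) % τ = s := by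
    rw [mul_comm, Nat.mul_add_mod, Nat.mod_eq_of_lt hs]
  unfold lcbFun
  simp only [h1, h2]

lemma lcb_phaseInd (T τ : ℕ) (u0 : Fin n) (d : Fin (n + 1) × Fin k)
    (R : Multiset (Fin (n + 1) × Fin k)) :
    PhaseInd τ (⟨lcbFun T τ u0 d R, lcb_causal T τ u0 d R⟩ : Alg k n T) := by
  intro q i j s hs hi hj h
  simp only
  rw [lcb_at T τ u0 d R q i s hs hi, lcb_at T τ u0 d R q j s hs hj, pl_congr]
  intro l hl
  have hli : i * τ + l < T := by omega
  have hlj : j * τ + l < T := by omega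
  simp only [qext, hli, hlj, dif_pos]
  exact h l hl hli hlj

lemma lcb_committed (T τ : ℕ) (hτ : 0 < τ) (u0 : Fin n) (d : Fin (n + 1) × Fin k)
    (R : Multiset (Fin (n + 1) × Fin k)) (hR : R.card = τ) (δ : Fin k → ℕ)
    (c : Fin (n + 1) → ℕ) (Z : Finset (Fin k)) (hF : Feas δ c Z R) :
    Committed τ δ Z (⟨lcbFun T τ u0 d R, lcb_causal T τ u0 d R⟩ : Alg k n T) := by
  intro q
  refine ⟨fun t => hF.2.1 _ (pl_mem d R _ τ hR _ (Nat.mod_lt _ hτ)), fun j hj a ha => ?_⟩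
  refine (hF.2.2 a ha).trans ?_
  set w : ℕ → Fin n := fun i => qext u0 q (j * τ + i) with hw
  have e : (R.map Prod.snd).count a
      = ((Finset.range τ).filter (fun i => (pl d R w i).2 = a)).card := by
    conv_lhs => rw [← st_full d R w τ hR]
    rw [Multiset.map_map, Multiset.count_map, Finset.card_def, Finset.filter_val]
    congr 1
    apply Multiset.filter_congr
    intro x _
    exact eq_comm
  rw [e]
  unfold pullsInPhase
  have hlt : ∀ i, i < τ → j * τ + i < T := by intro i hi; rw [add_mul] at hj; omega
  apply Finset.card_le_card_of_injOn
    (fun i => if h : j * τ + i < T then (⟨j * τ + i, h⟩ : Fin T) else ⟨0, by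
      have := hlt 0 hτ; omega⟩)
  · intro i hi
    simp only [Finset.coe_filter, Finset.mem_range, Set.mem_ofPred_eq] at hi
    have h := hlt i hi.1
    simp only [h, dif_pos, Finset.coe_filter, Finset.mem_univ, true_and, Set.mem_ofPred_eq]
    refine ⟨by omega, by rw [add_mul]; omega, ?_⟩
    rw [lcb_at T τ u0 d R q j i hi.1 h]
    exact hi.2
  · intro i hi i' hi' hii
    simp only [Finset.coe_filter, Finset.mem_range, Set.mem_ofPred_eq] at hi hi'
    simp only [hlt i hi.1, hlt i' hi'.1, dif_pos, Fin.mk.injEq] at hii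
    omega

end Greedy

lemma first_sum {T τ : ℕ} (hT : τ ≤ T) {M : Type*} [AddCommMonoid M] (F : Fin T → M) (F' : ℕ → M)
    (h : ∀ t : Fin T, (t : ℕ) < τ → F t = F' t) :
    ∑ t ∈ Finset.univ.filter (fun t : Fin T => (t : ℕ) < τ), F t
      = ∑ i ∈ Finset.range τ, F' i := by
  rw [Finset.sum_congr rfl (g := fun t : Fin T => F' t) (by
    intro t ht; exact h t (Finset.mem_filter.1 ht).2), Finset.sum_filter,
    Fin.sum_univ_eq_sum_range (fun i => if i < τ then F' i else 0), ← Finset.sum_filter]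
  congr 1
  ext i
  simp
  omega

lemma sum_cplusBase_le {n τ : ℕ} (P : Fin n → ℝ) (hPsum : ∑ u, P u = 1)
    (hcz : ∀ u : Fin n, 0 ≤ P u * (τ : ℝ) - Real.sqrt ((τ : ℝ) * Real.log (τ : ℝ))) :
    ∑ u, cplusBase P τ u ≤ τ := by
  have : (∑ u, (cplusBase P τ u : ℝ)) ≤ τ := by
    calc (∑ u, (cplusBase P τ u : ℝ)) ≤ ∑ u, P u * τ := by
          apply Finset.sum_le_sum
          intro u _
          have h1 : (cplusBase P τ u : ℝ) ≤ P u * τ - Real.sqrt ((τ : ℝ) * Real.log (τ : ℝ)) :=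
            Nat.floor_le (hcz u)
          have := Real.sqrt_nonneg ((τ : ℝ) * Real.log (τ : ℝ))
          linarith
      _ = τ := by rw [← Finset.sum_mul, hPsum, one_mul]
  exact_mod_cast this

lemma sum_cplus {n τ : ℕ} (P : Fin n → ℝ) (hPsum : ∑ u, P u = 1)
    (hcz : ∀ u : Fin n, 0 ≤ P u * (τ : ℝ) - Real.sqrt ((τ : ℝ) * Real.log (τ : ℝ))) :
    ∑ v, cplus P τ v = τ := by
  have := sum_cplusBase_le P hPsum hcz
  rw [Fin.sum_univ_castSucc]
  simp only [cplus, Fin.snoc_castSucc, Fin.snoc_last]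
  omega

lemma muPlus_bounds {k n : ℕ} (μ : Fin n → Fin k → ℝ) (hμ : ∀ u a, 0 ≤ μ u a ∧ μ u a ≤ 1)
    (v : Fin (n + 1)) (a : Fin k) : 0 ≤ muPlus μ v a ∧ muPlus μ v a ≤ 1 := by
  induction v using Fin.lastCases with
  | last => simp [muPlus]
  | cast u => simpa [muPlus] using hμ u a

lemma cnt_eq_fut {n T τ : ℕ} (hT : τ ≤ T) (u0 : Fin n) (q : Fin T → Fin n) (u : Fin n) :
    cnt τ q u = fut τ (qext u0 q) 0 u := by
  unfold cnt fut
  rw [← Finset.filter_filter, Finset.card_filter, Finset.card_filter,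
    first_sum hT _ (fun i => if qext u0 q i = u then 1 else 0), Finset.range_eq_Ico]
  intro t _
  simp [qext]

lemma lcb_pointwise {k n T τ : ℕ} (hτ : 0 < τ) (hT : τ ≤ T) (P : Fin n → ℝ)
    (μ : Fin n → Fin k → ℝ) (hμ : ∀ u a, 0 ≤ μ u a ∧ μ u a ≤ 1)
    (u0 : Fin n) (d : Fin (n + 1) × Fin k)
    (R : Multiset (Fin (n + 1) × Fin k)) (hR : R.card = τ) (δ : Fin k → ℕ)
    (Z : Finset (Fin k)) (hF : Feas δ (cplus P τ) Z R) (q : Fin T → Fin n) :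
    (R.map (fun x => muPlus μ x.1 x.2)).sum
        - τ * ∑ u, (if cnt τ q u < cplusBase P τ u then (1 : ℝ) else 0) ≤
      ∑ t ∈ Finset.univ.filter (fun t : Fin T => (t : ℕ) < τ),
        μ (q t) (lcbFun T τ u0 d R q t) := by
  have e : ∑ t ∈ Finset.univ.filter (fun t : Fin T => (t : ℕ) < τ),
        μ (q t) (lcbFun T τ u0 d R q t)
      = ∑ i ∈ Finset.range τ, μ (qext u0 q i) (pl d R (qext u0 q) i).2 := by
    apply first_sum hT
    intro t ht
    have h := lcb_at T τ u0 d R q 0 t ht (by simp)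
    simp only [zero_mul, zero_add] at h
    rw [← h]
    simp [qext]
  by_cases hg : ∀ u, cplusBase P τ u ≤ cnt τ q u
  · have hz : ∑ u, (if cnt τ q u < cplusBase P τ u then (1 : ℝ) else 0) = 0 := by
      apply Finset.sum_eq_zero
      intro u _
      rw [if_neg (not_lt.2 (hg u))]
    rw [hz, mul_zero, sub_zero, e]
    apply greedy_good d R _ τ hR μ (fun u a => (hμ u a).1)
    intro u
    rw [hF.1, ← cnt_eq_fut hT u0 q u]
    simpa [cplus] using hg u
  · push Not at hg
    obtain ⟨u, hu⟩ := hg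
    have h1 : (1 : ℝ) ≤ ∑ u, (if cnt τ q u < cplusBase P τ u then (1 : ℝ) else 0) := by
      calc (1 : ℝ) = if cnt τ q u < cplusBase P τ u then (1 : ℝ) else 0 := by rw [if_pos hu]
        _ ≤ _ := Finset.single_le_sum
          (f := fun u => if cnt τ q u < cplusBase P τ u then (1 : ℝ) else 0)
          (fun i _ => by positivity) (Finset.mem_univ u)
    have h2 : (R.map (fun x => muPlus μ x.1 x.2)).sum ≤ τ := by
      have := Multiset.sum_le_card_nsmul (R.map (fun x => muPlus μ x.1 x.2)) (1 : ℝ) (by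
        intro x hx
        obtain ⟨y, _, rfl⟩ := Multiset.mem_map.1 hx
        exact (muPlus_bounds μ hμ _ _).2)
      simpa [hR] using this
    have h3 : 0 ≤ ∑ t ∈ Finset.univ.filter (fun t : Fin T => (t : ℕ) < τ),
        μ (q t) (lcbFun T τ u0 d R q t) := Finset.sum_nonneg fun t _ => (hμ _ _).1
    have h4 : (0 : ℝ) < τ := by exact_mod_cast hτ
    nlinarith

lemma pico_pointwise {k n T τ : ℕ} (hT : τ ≤ T) (P : Fin n → ℝ) (hPsum : ∑ u, P u = 1)
    (hcz : ∀ u : Fin n, 0 ≤ P u * (τ : ℝ) - Real.sqrt ((τ : ℝ) * Real.log (τ : ℝ)))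
    (μ : Fin n → Fin k → ℝ) (hμ : ∀ u a, 0 ≤ μ u a ∧ μ u a ≤ 1)
    (δ : Fin k → ℕ) (Z : Finset (Fin k)) (A : Alg k n T) (hA : Committed τ δ Z A)
    (q : Fin T → Fin n) :
    ∑ t ∈ Finset.univ.filter (fun t : Fin T => (t : ℕ) < τ), μ (q t) (A.1 q t)
      ≤ DOAlgR (muPlus μ) δ (cplus P τ) Z + ∑ u, ((cnt τ q u - cplusBase P τ u : ℕ) : ℝ) := by
  obtain ⟨C, hC, hCc⟩ := exists_of_count (cplus P τ)
  set S := Finset.univ.filter (fun t : Fin T => (t : ℕ) < τ) with hS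
  set R : Multiset (Fin (n + 1) × Fin k) :=
    S.val.map (fun t => (Fin.castSucc (q t), A.1 q t)) with hRdef
  have hRc : R.card = C.card := by
    rw [hCc, sum_cplus P hPsum hcz, hRdef, Multiset.card_map]
    exact card_first hT
  obtain ⟨R', h1, h2, h3⟩ := relabel R C hRc (fun x => muPlus μ x.1 x.2)
    (fun x => (muPlus_bounds μ hμ _ _).1) (fun x => (muPlus_bounds μ hμ _ _).2)
  have hsnd : R.map Prod.snd = S.val.map (fun t => A.1 q t) := by
    rw [hRdef, Multiset.map_map]; rfl
  have hfst : R.map Prod.fst = S.val.map (fun t => Fin.castSucc (q t)) := by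
    rw [hRdef, Multiset.map_map]; rfl
  have hF : Feas δ (cplus P τ) Z R' := by
    refine ⟨?_, ?_, ?_⟩
    · rw [h1]; exact hC
    · intro x hx
      have hx2 : x.2 ∈ R'.map Prod.snd := Multiset.mem_map_of_mem _ hx
      rw [h2, hsnd] at hx2
      obtain ⟨t, _, ht⟩ := Multiset.mem_map.1 hx2
      rw [← ht]; exact (hA q).1 t
    · intro a ha
      refine ((hA q).2 0 (by simpa using hT) a ha).trans (le_of_eq ?_)
      rw [h2, hsnd, Multiset.count_map, ← Finset.filter_val, ← Finset.card_def, hS,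
        Finset.filter_filter]
      unfold pullsInPhase
      congr 1
      ext t
      simp [eq_comm]
  have hle := le_doalg (muPlus μ) δ (cplus P τ) Z R' hF
  have hsum : ∑ t ∈ S, μ (q t) (A.1 q t) = (R.map (fun x => muPlus μ x.1 x.2)).sum := by
    rw [hRdef, Multiset.map_map, Finset.sum_eq_multiset_sum]
    congr 1
    apply Multiset.map_congr rfl
    intro t _
    simp [muPlus]
  have hcd : ((R.map Prod.fst - C).card : ℝ) = ∑ u, ((cnt τ q u - cplusBase P τ u : ℕ) : ℝ) := by
    rw [← sum_count_card, Fin.sum_univ_castSucc, Nat.cast_add, Nat.cast_sum]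
    have hl : (R.map Prod.fst - C).count (Fin.last n) = 0 := by
      have : (R.map Prod.fst).count (Fin.last n) = 0 := by
        rw [Multiset.count_eq_zero, hfst]
        intro hx
        obtain ⟨t, _, ht⟩ := Multiset.mem_map.1 hx
        exact Fin.castSucc_ne_last _ ht
      rw [Multiset.count_sub, this, Nat.zero_sub]
    rw [hl, Nat.cast_zero, add_zero]
    apply Finset.sum_congr rfl
    intro u _
    have hc : (R.map Prod.fst).count (Fin.castSucc u) = cnt τ q u := by
      rw [hfst, Multiset.count_map, ← Finset.filter_val, ← Finset.card_def, hS,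
        Finset.filter_filter]
      unfold cnt
      congr 1
      ext t
      simp [eq_comm]
    rw [Multiset.count_sub, hc, hC]
    simp [cplus]
  rw [hsum, ← hcd]
  linarith

lemma pico_bound {k n T τ : ℕ} (hτ : 2 ≤ τ) (hT : τ ≤ T) (P : Fin n → ℝ) (hP : ∀ u, 0 < P u)
    (hPsum : ∑ u, P u = 1)
    (hcz : ∀ u : Fin n, 0 ≤ P u * (τ : ℝ) - Real.sqrt ((τ : ℝ) * Real.log (τ : ℝ)))
    (μ : Fin n → Fin k → ℝ) (hμ : ∀ u a, 0 ≤ μ u a ∧ μ u a ≤ 1)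
    (δ : Fin k → ℕ) (Z : Finset (Fin k)) (A : Alg k n T) (hA : Committed τ δ Z A) :
    expFirstPhase k n T τ P μ A ≤ DOAlgR (muPlus μ) δ (cplus P τ) Z
      + (n : ℝ) * (Real.sqrt ((τ : ℝ) * Real.log (τ : ℝ)) + 2) := by
  set D := DOAlgR (muPlus μ) δ (cplus P τ) Z with hD
  set s := Real.sqrt ((τ : ℝ) * Real.log (τ : ℝ)) with hs
  have hτ2 : (2 : ℝ) ≤ τ := by exact_mod_cast hτ
  have hcle : ∀ u, (cplusBase P τ u : ℝ) ≤ τ := by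
    intro u
    have := (Finset.single_le_sum (f := cplusBase P τ) (fun _ _ => Nat.zero_le _)
      (Finset.mem_univ u)).trans (sum_cplusBase_le P hPsum hcz)
    exact_mod_cast this
  have hpt : ∀ (q : Fin T → Fin n) (u : Fin n), ((cnt τ q u - cplusBase P τ u : ℕ) : ℝ)
      ≤ cnt τ q u - cplusBase P τ u
        + τ * (if cnt τ q u < cplusBase P τ u then (1 : ℝ) else 0) := by
    intro q u
    split_ifs with h
    · rw [Nat.sub_eq_zero_of_le h.le]
      have := hcle u
      have h0 : (0 : ℝ) ≤ cnt τ q u := Nat.cast_nonneg _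
      push_cast
      linarith
    · rw [Nat.cast_sub (not_lt.1 h)]
      linarith
  have hu : ∀ u, ∑ q : Fin T → Fin n, seqProb T P q * ((cnt τ q u - cplusBase P τ u : ℕ) : ℝ)
      ≤ s + 2 := by
    intro u
    calc _ ≤ ∑ q : Fin T → Fin n, (seqProb T P q * (cnt τ q u : ℝ)
            - cplusBase P τ u * seqProb T P q
            + τ * (seqProb T P q * (if cnt τ q u < cplusBase P τ u then (1 : ℝ) else 0))) := by
          apply Finset.sum_le_sum
          intro q _
          have := mul_le_mul_of_nonneg_left (hpt q u) (seqProb_nonneg P hP q)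
          linarith
      _ ≤ P u * τ - cplusBase P τ u + τ * (1 / (τ : ℝ) ^ 2) := by
          rw [Finset.sum_add_distrib, Finset.sum_sub_distrib, ← Finset.mul_sum, ← Finset.mul_sum,
            exp_cnt hT P hPsum, sum_seqProb P hPsum, mul_one]
          have := bad_prob hτ hT P hP hPsum hcz u
          gcongr
      _ ≤ s + 2 := by
          have h1 : P u * τ - s < cplusBase P τ u + 1 := Nat.lt_floor_add_one _
          have h2 : (τ : ℝ) * (1 / (τ : ℝ) ^ 2) ≤ 1 := by
            have : (τ : ℝ) * (1 / (τ : ℝ) ^ 2) = 1 / τ := by field_simp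
            rw [this, div_le_one (by linarith)]
            linarith
          linarith
  unfold expFirstPhase
  calc _ ≤ ∑ q : Fin T → Fin n, (D * seqProb T P q
          + ∑ u, seqProb T P q * ((cnt τ q u - cplusBase P τ u : ℕ) : ℝ)) := by
        apply Finset.sum_le_sum
        intro q _
        rw [← Finset.mul_sum]
        have := mul_le_mul_of_nonneg_left
          (pico_pointwise hT P hPsum hcz μ hμ δ Z A hA q) (seqProb_nonneg P hP q)
        linarith
    _ = D + ∑ u, ∑ q : Fin T → Fin n,
          seqProb T P q * ((cnt τ q u - cplusBase P τ u : ℕ) : ℝ) := by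
        rw [Finset.sum_add_distrib, ← Finset.mul_sum, sum_seqProb P hPsum, mul_one,
          Finset.sum_comm]
    _ ≤ D + ∑ _u : Fin n, (s + 2) := by
        gcongr with u _
        exact hu u
    _ = _ := by simp; ring

/-- Lemma 1 of the paper: (i) the algorithm `LCB(Z)` is phase-independent, committed to `Z`,
and its expected first-phase reward is at least `DOAlg(c⁺, Z) − 2n/τ`; (ii) `DOAlg(c⁺, Z)` is
at least the expected first-phase reward of `PICO(Z)` up to `Õ(n√τ)`. -/
theorem lcb_approximates_pico_z
    (k n τ N : ℕ) (hk : 1 ≤ k) (hn : 1 ≤ n) (hτ : 2 ≤ τ) (hN : 1 ≤ N)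
    (P : Fin n → ℝ) (hP : ∀ u, 0 < P u) (hPsum : ∑ u, P u = 1)
    (μ : Fin n → Fin k → ℝ) (hμ : ∀ u a, 0 ≤ μ u a ∧ μ u a ≤ 1)
    (δ : Fin k → ℕ) (hδ : ∀ a, δ a ≤ τ)
    (hcz : ∀ u : Fin n, 0 ≤ P u * (τ : ℝ) - Real.sqrt ((τ : ℝ) * Real.log (τ : ℝ)))
    (Z : Finset (Fin k)) (hZne : Z.Nonempty) (hZfeas : ∑ a ∈ Z, δ a ≤ τ) :
    (∃ A : Alg k n (N * τ), PhaseInd τ A ∧ Committed τ δ Z A ∧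
        expFirstPhase k n (N * τ) τ P μ A
          ≥ DOAlgR (muPlus μ) δ (cplus P τ) Z - 2 * (n : ℝ) / (τ : ℝ)) ∧
    DOAlgR (muPlus μ) δ (cplus P τ) Z
      ≥ picoZReward k n (N * τ) τ P μ δ Z
        - (n : ℝ) * (Real.sqrt ((τ : ℝ) * Real.log (τ : ℝ)) + 2) := by
  have hT : τ ≤ N * τ := Nat.le_mul_of_pos_left τ hN
  have hτ2 : (2 : ℝ) ≤ τ := by exact_mod_cast hτ
  have hpart1 : ∃ A : Alg k n (N * τ), PhaseInd τ A ∧ Committed τ δ Z A ∧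
        expFirstPhase k n (N * τ) τ P μ A
          ≥ DOAlgR (muPlus μ) δ (cplus P τ) Z - 2 * (n : ℝ) / (τ : ℝ) := by
    obtain ⟨R, hF, hDR⟩ := doalg_attained (muPlus μ) δ (cplus P τ) Z hZne
      (by rw [sum_cplus P hPsum hcz]; exact hZfeas)
    have hRc : R.card = τ := by
      rw [← Multiset.card_map Prod.fst R, ← sum_count_card, ← sum_cplus P hPsum hcz]
      exact Finset.sum_congr rfl fun v _ => hF.1 v
    let u0 : Fin n := ⟨0, hn⟩
    let d : Fin (n + 1) × Fin k := (Fin.last n, ⟨0, hk⟩)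
    refine ⟨⟨lcbFun (N * τ) τ u0 d R, lcb_causal _ _ _ _ _⟩, lcb_phaseInd _ _ _ _ _,
      lcb_committed _ _ (by omega) _ _ R hRc δ _ Z hF, ?_⟩
    set D := DOAlgR (muPlus μ) δ (cplus P τ) Z with hD
    unfold expFirstPhase
    have hpt : ∀ q : Fin (N * τ) → Fin n,
        D * seqProb (N * τ) P q - τ * ∑ u, seqProb (N * τ) P q *
          (if cnt τ q u < cplusBase P τ u then (1 : ℝ) else 0) ≤
        seqProb (N * τ) P q * ∑ t ∈ Finset.univ.filter (fun t : Fin (N * τ) => (t : ℕ) < τ),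
          μ (q t) (lcbFun (N * τ) τ u0 d R q t) := by
      intro q
      have := mul_le_mul_of_nonneg_left
        (lcb_pointwise (by omega) hT P μ hμ u0 d R hRc δ Z hF q) (seqProb_nonneg P hP q)
      rw [← hDR] at this
      rw [← Finset.mul_sum]
      linarith
    have hb : ∑ u, ∑ q : Fin (N * τ) → Fin n, seqProb (N * τ) P q *
          (if cnt τ q u < cplusBase P τ u then (1 : ℝ) else 0) ≤ n * (1 / (τ : ℝ) ^ 2) := by
      calc _ ≤ ∑ _u : Fin n, 1 / (τ : ℝ) ^ 2 :=
            Finset.sum_le_sum fun u _ => bad_prob hτ hT P hP hPsum hcz u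
        _ = _ := by simp
    have hsum := Finset.sum_le_sum (s := Finset.univ) fun q _ => hpt q
    rw [Finset.sum_sub_distrib, ← Finset.mul_sum, ← Finset.mul_sum, sum_seqProb P hPsum,
      Finset.sum_comm] at hsum
    have h1 : (τ : ℝ) * (n * (1 / (τ : ℝ) ^ 2)) = n / τ := by field_simp
    have h2 := mul_le_mul_of_nonneg_left hb (by linarith : (0 : ℝ) ≤ τ)
    rw [h1] at h2
    have h3 : (2 : ℝ) * n / τ = n / τ + n / τ := by ring
    have h4 : (0 : ℝ) ≤ n / τ := by positivity
    refine ge_iff_le.2 (le_trans ?_ hsum)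
    linarith
  refine ⟨hpart1, ?_⟩
  obtain ⟨A, hA1, hA2, -⟩ := hpart1
  have hne : Nonempty {A : Alg k n (N * τ) // PhaseInd τ A ∧ Committed τ δ Z A} :=
    ⟨⟨A, hA1, hA2⟩⟩
  have : picoZReward k n (N * τ) τ P μ δ Z ≤ DOAlgR (muPlus μ) δ (cplus P τ) Z
      + (n : ℝ) * (Real.sqrt ((τ : ℝ) * Real.log (τ : ℝ)) + 2) := by
    unfold picoZReward
    apply ciSup_le
    intro B
    exact pico_bound hτ hT P hP hPsum hcz μ hμ δ Z B.1 B.2.2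
  linarith

end ExposureBandits
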